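/- Let A be an n×n matrix with ε-quasiseparable rank at most k, for some ε > 0. Then there exists a matrix δA with ‖δA‖₂ ≤ 2·√(max{n − 2k − 1, 0})·ε such that A + δA has quasiseparable rank at most k. In particular, if n ≤ 2k + 1, one may take δA = 0, since every n×n matrix with n ≤ 2k+1 automatically has quasiseparable rank at most k. -/

import Mathlib

open Matrix

/-- The spectral norm (operator 2-norm) of a matrix. -/
noncomputable def specNorm {𝕜 : Type*} [RCLike 𝕜] {m n : ℕ}
    (M : Matrix (Fin m) (Fin n) 𝕜) : ℝ :=
  ‖LinearMap.toContinuousLinearMap (Matrix.toEuclideanLin M)‖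

/-- The lower off-diagonal block `A[p+1:n, 1:p]` (1-based indexing). -/
def lowerBlock {α : Type*} {n : ℕ} (A : Matrix (Fin n) (Fin n) α) (p : ℕ) (hp : p < n) :
    Matrix (Fin (n - p)) (Fin p) α :=
  A.submatrix (fun i => ⟨p + i.1, by have := i.2; omega⟩) (fun j => ⟨j.1, by have := j.2; omega⟩)

/-- The upper off-diagonal block `A[1:p, p+1:n]` (1-based indexing). -/
def upperBlock {α : Type*} {n : ℕ} (A : Matrix (Fin n) (Fin n) α) (p : ℕ) (hp : p < n) :
    Matrix (Fin p) (Fin (n - p)) α :=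
  A.submatrix (fun i => ⟨i.1, by have := i.2; omega⟩) (fun j => ⟨p + j.1, by have := j.2; omega⟩)

/-- `A` has `ε`-quasiseparable rank at most `k`: every off-diagonal block admits a rank-`≤ k`
approximation within `ε` in the spectral norm (equivalently, `σ_{k+1}` of every off-diagonal
block is at most `ε`). -/
def EpsQSRankLE {𝕜 : Type*} [RCLike 𝕜] {n : ℕ} (A : Matrix (Fin n) (Fin n) 𝕜)
    (ε : ℝ) (k : ℕ) : Prop :=
  ∀ (p : ℕ), 1 ≤ p → ∀ hp : p < n,
    (∃ M, M.rank ≤ k ∧ specNorm (lowerBlock A p hp - M) ≤ ε) ∧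
    (∃ M, M.rank ≤ k ∧ specNorm (upperBlock A p hp - M) ≤ ε)

/-- `A` has lower quasiseparable rank at most `k`: every submatrix contained entirely in the
strictly lower triangular part has rank at most `k`. -/
def LowerQSRankLE {𝕜 : Type*} [Field 𝕜] {n : ℕ} (A : Matrix (Fin n) (Fin n) 𝕜) (k : ℕ) : Prop :=
  ∀ (u v : ℕ) (r : Fin u → Fin n) (c : Fin v → Fin n),
    (∀ i j, (c j : ℕ) < (r i : ℕ)) → (A.submatrix r c).rank ≤ k

/-- `A` has upper quasiseparable rank at most `k`: every submatrix contained entirely in the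
strictly upper triangular part has rank at most `k`. -/
def UpperQSRankLE {𝕜 : Type*} [Field 𝕜] {n : ℕ} (A : Matrix (Fin n) (Fin n) 𝕜) (k : ℕ) : Prop :=
  ∀ (u v : ℕ) (r : Fin u → Fin n) (c : Fin v → Fin n),
    (∀ i j, (r i : ℕ) < (c j : ℕ)) → (A.submatrix r c).rank ≤ k

/-- `A` has quasiseparable rank at most `k`. -/
def QSRankLE {𝕜 : Type*} [Field 𝕜] {n : ℕ} (A : Matrix (Fin n) (Fin n) 𝕜) (k : ℕ) : Prop :=
  LowerQSRankLE A k ∧ UpperQSRankLE A k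

open scoped Matrix.Norms.L2Operator in
lemma specNorm_eq_norm {m n : ℕ} (M : Matrix (Fin m) (Fin n) ℂ) : specNorm M = ‖M‖ := rfl

open scoped ComplexOrder in
lemma rank_conjT {m n : ℕ} (M : Matrix (Fin m) (Fin n) ℂ) : Mᴴ.rank = M.rank :=
  rank_conjTranspose M

lemma specNorm_conjTranspose {m n : ℕ} (M : Matrix (Fin m) (Fin n) ℂ) :
    specNorm Mᴴ = specNorm M := by
  rw [specNorm_eq_norm, specNorm_eq_norm, l2_opNorm_conjTranspose]

lemma specNorm_add_le {m n : ℕ} (M N : Matrix (Fin m) (Fin n) ℂ) :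
    specNorm (M + N) ≤ specNorm M + specNorm N := by
  unfold specNorm
  rw [map_add, map_add]
  exact norm_add_le _ _

lemma specNorm_mulVec {m n : ℕ} (M : Matrix (Fin m) (Fin n) ℂ) (x : EuclideanSpace ℂ (Fin n)) :
    ‖(WithLp.toLp 2 (M *ᵥ x.ofLp) : EuclideanSpace ℂ (Fin m))‖ ≤ specNorm M * ‖x‖ :=
  (LinearMap.toContinuousLinearMap (Matrix.toEuclideanLin M)).le_opNorm x

lemma sum_low {R : Type*} [AddCommMonoid R] {n p : ℕ} (hp : p < n) (f : Fin n → R)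
    (hf : ∀ j : Fin n, p ≤ j.1 → f j = 0) :
    ∑ j : Fin p, f ⟨j.1, by have := j.2; omega⟩ = ∑ j, f j := by
  refine Fintype.sum_of_injective (fun j : Fin p => (⟨j.1, by have := j.2; omega⟩ : Fin n))
    ?_ _ _ ?_ (fun _ => rfl)
  · intro a b h
    simpa [Fin.ext_iff] using h
  · intro i hi
    apply hf
    by_contra hlt
    exact hi ⟨⟨i.1, by omega⟩, rfl⟩

lemma sum_high {R : Type*} [AddCommMonoid R] {n p : ℕ} (hp : p < n) (f : Fin n → R)
    (hf : ∀ j : Fin n, j.1 < p → f j = 0) :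
    ∑ j : Fin (n - p), f ⟨p + j.1, by have := j.2; omega⟩ = ∑ j, f j := by
  refine Fintype.sum_of_injective
    (fun j : Fin (n - p) => (⟨p + j.1, by have := j.2; omega⟩ : Fin n)) ?_ _ _ ?_ (fun _ => rfl)
  · intro a b h
    simpa [Fin.ext_iff] using h
  · intro i hi
    apply hf
    by_contra hlt
    exact hi ⟨⟨i.1 - p, by have := i.2; omega⟩, by ext; simp; omega⟩

/-- Truncation of `A z` to the rows with index at least `q`. -/
noncomputable def yv {n : ℕ} (A : Matrix (Fin n) (Fin n) ℂ) (q : ℕ)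
    (z : EuclideanSpace ℂ (Fin n)) : EuclideanSpace ℂ (Fin n) :=
  WithLp.toLp 2 (fun i => if q ≤ i.1 then (A *ᵥ z.ofLp) i else 0)

/-- Extension by zero. -/
noncomputable def extz {n p : ℕ} (w : Fin p → ℂ) : EuclideanSpace ℂ (Fin n) :=
  WithLp.toLp 2 (fun j => if h : j.1 < p then w ⟨j.1, h⟩ else 0)

lemma lowerBlock_mulVec {n : ℕ} (A : Matrix (Fin n) (Fin n) ℂ) (p : ℕ) (hp : p < n)
    (z : EuclideanSpace ℂ (Fin n)) (hz : ∀ j : Fin n, p ≤ j.1 → z j = 0) (i : Fin (n - p)) :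
    (lowerBlock A p hp *ᵥ (fun j : Fin p => z ⟨j.1, by have := j.2; omega⟩)) i
      = (A *ᵥ z.ofLp) ⟨p + i.1, by have := i.2; omega⟩ := by
  simp only [mulVec, dotProduct, lowerBlock, submatrix_apply]
  exact sum_low hp (fun j => A ⟨p + i.1, by have := i.2; omega⟩ j * z j)
    (fun j hj => by simp [hz j hj])

lemma exists_vec {n : ℕ} (A : Matrix (Fin n) (Fin n) ℂ) (ε : ℝ) (k q t : ℕ)
    (hq : q = k + 1 + t) (hqn : q < n)
    (hM : ∃ M, M.rank ≤ k ∧ specNorm (lowerBlock A q hqn - M) ≤ ε)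
    (x : ℕ → EuclideanSpace ℂ (Fin n)) :
    ∃ z : EuclideanSpace ℂ (Fin n), ‖z‖ = 1 ∧ (∀ s < t, inner ℂ (x s) z = 0) ∧
      (∀ j : Fin n, q ≤ j.1 → z j = 0) ∧ ‖yv A q z‖ ≤ ε := by
  obtain ⟨M, hMr, hMn⟩ := hM
  let Φ : (Fin q → ℂ) →ₗ[ℂ] (Fin t → ℂ) × LinearMap.range M.mulVecLin :=
    LinearMap.prod
      (LinearMap.pi fun s : Fin t =>
        { toFun := fun w => inner ℂ (x s) (extz w)
          map_add' := by
            intro a b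
            rw [← inner_add_right]
            congr 1
            ext j
            simp only [extz, PiLp.add_apply, Pi.add_apply]
            split_ifs <;> simp
          map_smul' := by
            intro a b
            rw [RingHom.id_apply, smul_eq_mul, ← inner_smul_right]
            congr 1
            ext j
            simp only [extz, PiLp.smul_apply, Pi.smul_apply]
            split_ifs <;> simp })
      M.mulVecLin.rangeRestrict
  have hker : LinearMap.ker Φ ≠ ⊥ := by
    apply LinearMap.ker_ne_bot_of_finrank_lt
    rw [Module.finrank_prod, Module.finrank_fin_fun, Module.finrank_fin_fun]
    have : Module.finrank ℂ (LinearMap.range M.mulVecLin) ≤ k := hMr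
    omega
  obtain ⟨w0, hw0, hne⟩ := (Submodule.ne_bot_iff _).mp hker
  set c : ℝ := ‖(WithLp.toLp 2 w0 : EuclideanSpace ℂ (Fin q))‖ with hc
  have hc0 : c ≠ 0 := by
    rw [hc, norm_ne_zero_iff]
    intro h
    apply hne
    simpa using h
  let w : Fin q → ℂ := ((c⁻¹ : ℝ) : ℂ) • w0
  have hw : Φ w = 0 := by
    rw [map_smul, LinearMap.mem_ker.mp hw0, smul_zero]
  have hwn : ‖(WithLp.toLp 2 w : EuclideanSpace ℂ (Fin q))‖ = 1 := by
    have : (WithLp.toLp 2 w : EuclideanSpace ℂ (Fin q)) = ((c⁻¹ : ℝ) : ℂ) • WithLp.toLp 2 w0 := rfl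
    rw [this, norm_smul, ← hc, Complex.norm_real, norm_inv, Real.norm_eq_abs,
      abs_of_nonneg (norm_nonneg _)]
    exact inv_mul_cancel₀ hc0
  have hin : ∀ s < t, inner ℂ (x s) (extz w) = 0 := fun s hs =>
    congrFun (congrArg Prod.fst hw) ⟨s, hs⟩
  have hMw : M *ᵥ w = 0 := congrArg Subtype.val (congrArg Prod.snd hw)
  have hsup : ∀ j : Fin n, q ≤ j.1 → (extz w : EuclideanSpace ℂ (Fin n)) j = 0 := by
    intro j hj
    simp [extz, not_lt.mpr hj]
  have hres : (fun j : Fin q => (extz w : EuclideanSpace ℂ (Fin n)) ⟨j.1, by have := j.2; omega⟩)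
      = w := by
    funext j
    simp [extz]
  refine ⟨extz w, ?_, hin, hsup, ?_⟩
  · rw [← hwn, EuclideanSpace.norm_eq, EuclideanSpace.norm_eq]
    congr 1
    rw [← sum_low hqn _ (fun j hj => by rw [hsup j hj]; simp)]
    refine Finset.sum_congr rfl fun j _ => ?_
    exact congrArg (fun a : ℂ => ‖a‖ ^ 2) (congrFun hres j)
  · have h1 := specNorm_mulVec (lowerBlock A q hqn - M) (WithLp.toLp 2 w)
    rw [hwn, mul_one, sub_mulVec] at h1
    simp only [hMw, sub_zero] at h1
    refine le_trans (le_of_eq ?_) (h1.trans hMn)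
    rw [EuclideanSpace.norm_eq, EuclideanSpace.norm_eq]
    congr 1
    rw [← sum_high hqn _ (fun j hj => by simp [yv, not_le.mpr hj])]
    refine Finset.sum_congr rfl fun i _ => ?_
    have h2 := lowerBlock_mulVec A q hqn (extz w) hsup i
    rw [hres] at h2
    simp [yv, h2]

lemma exists_seq {n : ℕ} (A : Matrix (Fin n) (Fin n) ℂ) (ε : ℝ) (k : ℕ)
    (hA : ∀ p, 1 ≤ p → ∀ hp : p < n,
      ∃ M, M.rank ≤ k ∧ specNorm (lowerBlock A p hp - M) ≤ ε) (N : ℕ)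
    (hN : N ≤ n - (2 * k + 1)) :
    ∃ x : ℕ → EuclideanSpace ℂ (Fin n), ∀ t < N,
      ‖x t‖ = 1 ∧ (∀ s < t, inner ℂ (x s) (x t) = 0) ∧
      (∀ j : Fin n, k + 1 + t ≤ j.1 → x t j = 0) ∧ ‖yv A (k + 1 + t) (x t)‖ ≤ ε := by
  induction N with
  | zero => exact ⟨fun _ => 0, fun t ht => absurd ht (by omega)⟩
  | succ N ih =>
    obtain ⟨x, hx⟩ := ih (by omega)
    obtain ⟨z, hz⟩ := exists_vec A ε k (k + 1 + N) N rfl (by omega)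
      (hA _ (by omega) (by omega)) x
    refine ⟨Function.update x N z, fun t ht => ?_⟩
    have hlt : ∀ s < N, Function.update x N z s = x s := fun s hs =>
      Function.update_of_ne (by omega) _ _
    rcases Nat.lt_succ_iff_lt_or_eq.mp ht with h | rfl
    · rw [hlt t h]
      obtain ⟨h1, h2, h3, h4⟩ := hx t h
      exact ⟨h1, fun s hs => by rw [hlt s (hs.trans h)]; exact h2 s hs, h3, h4⟩
    · rw [Function.update_self]
      obtain ⟨h1, h2, h3, h4⟩ := hz
      exact ⟨h1, fun s hs => by rw [hlt s hs]; exact h2 s hs, h3, h4⟩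

lemma lowerQS_of_blocks {n : ℕ} (F : Matrix (Fin n) (Fin n) ℂ) (k : ℕ)
    (h : ∀ p, ∀ hp : p < n, k < p → p + k < n → (lowerBlock F p hp).rank ≤ k) :
    LowerQSRankLE F k := by
  intro u v r c hrc
  rcases Nat.eq_zero_or_pos u with rfl | hu
  · exact (rank_le_height _).trans (Nat.zero_le _)
  obtain ⟨i0, -, hi0⟩ := Finset.exists_min_image (Finset.univ : Finset (Fin u))
    (fun i => (r i).1) ⟨⟨0, hu⟩, Finset.mem_univ _⟩
  set p := (r i0).1 with hpdef
  have hp : p < n := (r i0).2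
  have hsub : F.submatrix r c = (lowerBlock F p hp).submatrix
      (fun i => ⟨(r i).1 - p, by have := (r i).2; have := hi0 i (Finset.mem_univ _); omega⟩)
      (fun j => ⟨(c j).1, hrc i0 j⟩) := by
    ext i j
    simp only [lowerBlock, submatrix_apply]
    congr 1
    ext
    have := hi0 i (Finset.mem_univ _)
    simp only
    omega
  rw [hsub]
  refine (rank_submatrix_le _ _ _).trans ?_
  by_cases h1 : k < p
  · by_cases h2 : p + k < n
    · exact h p hp h1 h2
    · exact (rank_le_height _).trans (by omega)
  · exact (rank_le_width _).trans (by omega)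

lemma lowerQS_congr {n : ℕ} (F G : Matrix (Fin n) (Fin n) ℂ) (k : ℕ)
    (h : ∀ i j : Fin n, j.1 < i.1 → F i j = G i j) (hG : LowerQSRankLE G k) :
    LowerQSRankLE F k := by
  intro u v r c hrc
  have : F.submatrix r c = G.submatrix r c := by
    ext i j
    exact h _ _ (hrc i j)
  rw [this]
  exact hG u v r c hrc

lemma upperQS_of_conj {n : ℕ} (F : Matrix (Fin n) (Fin n) ℂ) (k : ℕ)
    (h : LowerQSRankLE Fᴴ k) : UpperQSRankLE F k := by
  intro u v r c hrc
  have := h v u c r (fun i j => hrc j i)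
  rwa [← conjTranspose_submatrix, rank_conjT] at this

lemma lower_main {n : ℕ} (A : Matrix (Fin n) (Fin n) ℂ) (ε : ℝ) (k : ℕ) (hε : 0 < ε)
    (hA : ∀ p, 1 ≤ p → ∀ hp : p < n,
      ∃ M, M.rank ≤ k ∧ specNorm (lowerBlock A p hp - M) ≤ ε) :
    ∃ δ : Matrix (Fin n) (Fin n) ℂ,
      specNorm δ ≤ Real.sqrt ((n - (2 * k + 1) : ℕ) : ℝ) * ε ∧
      (∀ i j : Fin n, i.1 ≤ j.1 → δ i j = 0) ∧ LowerQSRankLE (A + δ) k := by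
  set N := n - (2 * k + 1) with hN
  obtain ⟨x, hx⟩ := exists_seq A ε k hA N le_rfl
  have horth : ∀ s t : Fin N, inner ℂ (x s) (x t) = if s = t then (1 : ℂ) else 0 := by
    intro s t
    split_ifs with h
    · subst h
      rw [inner_self_eq_norm_sq_to_K, (hx s s.2).1]
      simp
    · rcases lt_or_gt_of_ne (fun e => h (Fin.ext e) : s.1 ≠ t.1) with h' | h'
      · exact (hx t t.2).2.1 s h'
      · rw [← inner_conj_symm, (hx s s.2).2.1 t h', map_zero]
  have hon : Orthonormal ℂ (fun t : Fin N => x t) := orthonormal_iff_ite.mpr horth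
  let δ : Matrix (Fin n) (Fin n) ℂ := fun i j =>
    -∑ t : Fin N, yv A (k + 1 + t) (x t) i * star (x t j)
  have hδ : ∀ z : EuclideanSpace ℂ (Fin n), (WithLp.toLp 2 (δ *ᵥ z.ofLp) : EuclideanSpace ℂ (Fin n))
      = -∑ t : Fin N, (inner ℂ (x t) z) • yv A (k + 1 + t) (x t) := by
    intro z
    ext i
    simp only [mulVec, dotProduct, δ, PiLp.neg_apply, WithLp.ofLp_sum, WithLp.ofLp_smul,
      Finset.sum_apply, Pi.smul_apply, smul_eq_mul, PiLp.inner_apply, neg_mul,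
      Finset.sum_neg_distrib, Finset.sum_mul, RCLike.inner_apply]
    rw [Finset.sum_comm]
    congr 1
    refine Finset.sum_congr rfl fun t _ => Finset.sum_congr rfl fun j _ => ?_
    simp only [starRingEnd_apply]
    ring
  refine ⟨δ, ?_, ?_, ?_⟩
  · refine ContinuousLinearMap.opNorm_le_bound _ (by positivity) fun z => ?_
    change ‖(WithLp.toLp 2 (δ *ᵥ z.ofLp) : EuclideanSpace ℂ (Fin n))‖ ≤ _
    rw [hδ, norm_neg]
    have h1 : ‖∑ t : Fin N, (inner ℂ (x t) z) • yv A (k + 1 + t) (x t)‖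
        ≤ (∑ t : Fin N, ‖inner ℂ (x t) z‖) * ε := by
      rw [Finset.sum_mul]
      refine norm_sum_le_of_le _ fun t _ => ?_
      rw [norm_smul]
      exact mul_le_mul_of_nonneg_left (hx t t.2).2.2.2 (norm_nonneg _)
    have h2 : ∑ t : Fin N, ‖inner ℂ (x t) z‖ ≤ Real.sqrt (N : ℝ) * ‖z‖ := by
      refine abs_le_of_sq_le_sq' ?_ (by positivity) |>.2
      rw [mul_pow, Real.sq_sqrt (Nat.cast_nonneg _)]
      refine (sq_sum_le_card_mul_sum_sq).trans ?_
      rw [Finset.card_univ, Fintype.card_fin]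
      exact mul_le_mul_of_nonneg_left (hon.sum_inner_products_le z) (Nat.cast_nonneg _)
    calc _ ≤ _ := h1
      _ ≤ (Real.sqrt (N : ℝ) * ‖z‖) * ε := mul_le_mul_of_nonneg_right h2 hε.le
      _ = _ := by ring
  · intro i j hij
    simp only [δ, neg_eq_zero]
    refine Finset.sum_eq_zero fun t _ => ?_
    by_cases h : k + 1 + t.1 ≤ i.1
    · rw [(hx t t.2).2.2.1 j (by omega)]
      simp
    · simp [yv, h]
  · apply lowerQS_of_blocks
    intro p hp h1 h2
    let w : Fin (p - k) → (Fin p → ℂ) := fun t j => x t ⟨j.1, by have := j.2; omega⟩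
    have hsup : ∀ t : Fin (p - k), ∀ j : Fin n, p ≤ j.1 → x t j = 0 := fun t j hj =>
      (hx t (by have := t.2; omega)).2.2.1 j (by have := t.2; omega)
    have hkill : ∀ t : Fin (p - k), w t ∈ LinearMap.ker (lowerBlock (A + δ) p hp).mulVecLin := by
      intro t
      have htN : t.1 < N := by have := t.2; omega
      rw [LinearMap.mem_ker, mulVecLin_apply]
      funext i
      rw [lowerBlock_mulVec (A + δ) p hp (x t) (hsup t) i, add_mulVec]
      have h3 := hδ (x t)
      have h4 : ∑ s : Fin N, (inner ℂ (x s) (x t)) • yv A (k + 1 + s) (x s)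
          = yv A (k + 1 + t) (x t) := by
        rw [Finset.sum_eq_single (⟨t.1, htN⟩ : Fin N)]
        · have := horth ⟨t.1, htN⟩ ⟨t.1, htN⟩
          simp only [if_true] at this
          rw [this, one_smul]
        · intro s _ hs
          have := horth s ⟨t.1, htN⟩
          rw [if_neg hs] at this
          simp only at this
          rw [this, zero_smul]
        · simp
      rw [h4] at h3
      have h5 := congrArg (fun v : EuclideanSpace ℂ (Fin n) =>
        v ⟨p + i.1, by have := i.2; omega⟩) h3
      simp only [PiLp.neg_apply, yv] at h5
      rw [if_pos (by have := t.2; omega)] at h5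
      rw [Pi.add_apply, h5, add_neg_cancel, Pi.zero_apply]
    have hli : LinearIndependent ℂ w := by
      have hli0 : LinearIndependent ℂ (fun t : Fin (p - k) => x t) :=
        hon.linearIndependent.comp (fun t : Fin (p - k) => (⟨t.1, by have := t.2; omega⟩ : Fin N))
          (fun a b h => by simpa [Fin.ext_iff] using h)
      rw [Fintype.linearIndependent_iff] at hli0 ⊢
      intro g hg
      apply hli0
      ext j
      simp only [WithLp.ofLp_sum, WithLp.ofLp_smul, Finset.sum_apply, Pi.smul_apply]
      by_cases hj : j.1 < p
      · have := congrFun hg ⟨j.1, hj⟩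
        simpa [w] using this
      · exact Finset.sum_eq_zero fun t _ => by rw [hsup t j (by omega), smul_zero]
    have hli' : LinearIndependent ℂ
        (fun t => (⟨w t, hkill t⟩ : LinearMap.ker (lowerBlock (A + δ) p hp).mulVecLin)) :=
      LinearIndependent.of_comp (Submodule.subtype _) hli
    have h6 := hli'.fintype_card_le_finrank
    have h7 := (lowerBlock (A + δ) p hp).mulVecLin.finrank_range_add_finrank_ker
    rw [Module.finrank_fin_fun] at h7
    rw [Fintype.card_fin] at h6
    change Module.finrank ℂ (LinearMap.range _) ≤ k
    omega

/-- **Refined quasiseparable approximation bound.**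
If `A` has `ε`-quasiseparable rank at most `k` with `ε > 0`, then there exists `δA` with
`‖δA‖₂ ≤ 2·√(max{n - 2k - 1, 0})·ε` such that `A + δA` has quasiseparable rank at most `k`;
in particular, if `n ≤ 2k + 1` one may take `δA = 0`, since every `n × n` matrix with
`n ≤ 2k + 1` automatically has quasiseparable rank at most `k`. -/
theorem exists_quasisep_approximant_refined
    {n : ℕ} (A : Matrix (Fin n) (Fin n) ℂ) (ε : ℝ) (k : ℕ)
    (hε : 0 < ε) (hA : EpsQSRankLE A ε k) :
    (∃ δA : Matrix (Fin n) (Fin n) ℂ,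
      specNorm δA ≤ 2 * Real.sqrt ((n - (2 * k + 1) : ℕ) : ℝ) * ε ∧
      QSRankLE (A + δA) k) ∧
    (n ≤ 2 * k + 1 → QSRankLE A k) := by
  constructor
  · obtain ⟨δ₁, hn₁, hs₁, hq₁⟩ := lower_main A ε k hε (fun p h1 hp => (hA p h1 hp).1)
    obtain ⟨δ₂, hn₂, hs₂, hq₂⟩ := lower_main Aᴴ ε k hε (fun p h1 hp => by
      obtain ⟨M, hM, hMn⟩ := (hA p h1 hp).2
      refine ⟨Mᴴ, by rwa [rank_conjT], ?_⟩
      have : lowerBlock Aᴴ p hp - Mᴴ = (upperBlock A p hp - M)ᴴ := by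
        rw [conjTranspose_sub]
        rfl
      rwa [this, specNorm_conjTranspose])
    refine ⟨δ₁ + δ₂ᴴ, ?_, ?_, ?_⟩
    · refine (specNorm_add_le _ _).trans ?_
      rw [specNorm_conjTranspose]
      linarith
    · refine lowerQS_congr _ (A + δ₁) k (fun i j hij => ?_) hq₁
      simp [hs₂ j i hij.le]
    · apply upperQS_of_conj
      refine lowerQS_congr _ (Aᴴ + δ₂) k (fun i j hij => ?_) hq₂
      simp [hs₁ j i hij.le]
  · intro hn
    exact ⟨lowerQS_of_blocks _ _ (fun p hp h1 h2 => by omega),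
      upperQS_of_conj _ _ (lowerQS_of_blocks _ _ (fun p hp h1 h2 => by omega))⟩
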